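/- Every monomial M in the generators ψ₁, …, ψ_n and D_{ij} of R_n can be written in R_n in the form M = ε·∏_{S∈P} D_{S, a(S)+|S|−1}, where ε ∈ {+1, −1} is a sign, P is a set partition of {1,…,n}, and a : P → ℤ_{≥0}; moreover the triple (ε, P, a) is uniquely determined by M, i.e. if ε·∏_{S∈P} D_{S, a(S)+|S|−1} = ε'·∏_{S∈P'} D_{S, a'(S)+|S|−1} in R_n then ε = ε', P = P' and a = a'. (The blocks S ∈ P are the connected components of M.) -/

import Mathlib

open MvPolynomial

/-- The generators of the algebra `R_n`: one generator `ψ_i` for each `i ∈ {1,…,n}` and one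
generator `D_{ij} = D_{ji}` for each 2-element subset `{i,j} ⊆ {1,…,n}`. -/
abbrev Gen (n : ℕ) : Type := Fin n ⊕ {p : Sym2 (Fin n) // ¬ p.IsDiag}

/-- The polynomial generator corresponding to `ψ_i`. -/
noncomputable def Ppsi {n : ℕ} (i : Fin n) : MvPolynomial (Gen n) ℚ := X (Sum.inl i)

/-- The polynomial generator corresponding to `D_{ij}` (for `i ≠ j`; junk value `0` if
`i = j`). -/
noncomputable def PD {n : ℕ} (i j : Fin n) : MvPolynomial (Gen n) ℚ :=
  if h : i = j then 0
  else X (Sum.inr ⟨s(i, j), fun hd => h (Sym2.mk_isDiag_iff.mp hd)⟩)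

/-- The ideal of relations of `R_n`: `D_{ij}ψ_i = −D_{ij}²` for all `i ≠ j` (which by the
symmetry `D_{ij} = D_{ji}` of the generators also gives `D_{ij}ψ_j = −D_{ij}²`), and
`D_{ij}D_{ik} = D_{ij}D_{jk} = D_{ik}D_{jk}` for pairwise distinct `i, j, k`. -/
noncomputable def relIdeal (n : ℕ) : Ideal (MvPolynomial (Gen n) ℚ) :=
  Ideal.span
    ({p | ∃ i j : Fin n, i ≠ j ∧ p = PD i j * Ppsi i + PD i j ^ 2} ∪
     {p | ∃ i j k : Fin n, i ≠ j ∧ i ≠ k ∧ j ≠ k ∧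
        (p = PD i j * PD i k - PD i j * PD j k ∨
         p = PD i j * PD i k - PD i k * PD j k)})

/-- The commutative `ℚ`-algebra `R_n`, generated by `ψ₁, …, ψ_n` and `D_{ij} = D_{ji}`
subject to the relations `D_{ij}ψ_i = D_{ij}ψ_j = −D_{ij}²` and
`D_{ij}D_{ik} = D_{ij}D_{jk} = D_{ik}D_{jk}` (the universal relations among diagonal and
cotangent line classes on `M_{g|n}`). -/
abbrev Rring (n : ℕ) : Type := MvPolynomial (Gen n) ℚ ⧸ relIdeal n

/-- The class `ψ_i ∈ R_n`. -/
noncomputable def psiCl {n : ℕ} (i : Fin n) : Rring n :=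
  Ideal.Quotient.mk (relIdeal n) (Ppsi i)

/-- The class `D_{ij} ∈ R_n`. -/
noncomputable def DCl {n : ℕ} (i j : Fin n) : Rring n :=
  Ideal.Quotient.mk (relIdeal n) (PD i j)

/-- The class `D_{S,a} ∈ R_n`, relative to a choice of `i ∈ S`:
`D_{S,a} = (−1)^{|S|−1} · (∏_{j ∈ S, j ≠ i} D_{ij}) · ψ_i^{a−|S|+1}`; for `S = {i}` this is
`ψ_i^a`.  (Meaningful for `i ∈ S` and `a ≥ |S| − 1`.) -/
noncomputable def DSa {n : ℕ} (S : Finset (Fin n)) (a : ℕ) (i : Fin n) : Rring n :=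
  (-1) ^ (S.card - 1) * (∏ j ∈ S.erase i, DCl i j) * psiCl i ^ (a + 1 - S.card)

/-- The image in `R_n` of a generator. -/
noncomputable def genCl {n : ℕ} (g : Gen n) : Rring n :=
  Ideal.Quotient.mk (relIdeal n) (X g)

/-- `D_{S,a}` with the canonical choice `i = min S` of the defining index (junk value `1` for
`S = ∅`); by Statement 9 this is the common value of `DSa S a i` over all `i ∈ S`. -/
noncomputable def DSaMin {n : ℕ} (S : Finset (Fin n)) (a : ℕ) : Rring n :=
  if h : S.Nonempty then DSa S a (S.min' h) else 1
section ClassRelations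

variable {n : ℕ}

lemma PD_comm (i j : Fin n) : PD i j = PD j i := by
  unfold PD
  by_cases h : i = j
  · simp [h]
  · simp only [h, Ne.symm h, dif_neg, not_false_eq_true, Sym2.eq_swap]

lemma DCl_comm (i j : Fin n) : DCl i j = DCl j i := by
  unfold DCl
  rw [PD_comm]

lemma DCl_mul_psiCl_left {i j : Fin n} (h : i ≠ j) :
    DCl i j * psiCl i = -(DCl i j * DCl i j) := by
  have hmem : PD i j * Ppsi i + PD i j ^ 2 ∈ relIdeal n :=
    Ideal.subset_span (Or.inl ⟨i, j, h, rfl⟩)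
  have h0 := Ideal.Quotient.eq_zero_iff_mem.mpr hmem
  rw [map_add, map_mul, map_pow, pow_two] at h0
  exact eq_neg_of_add_eq_zero_left h0

lemma DCl_mul_psiCl {i j : Fin n} (h : i ≠ j) :
    DCl i j * psiCl i = DCl i j * psiCl j := by
  rw [DCl_mul_psiCl_left h, DCl_comm i j, DCl_mul_psiCl_left h.symm]

lemma DCl_mul_DCl {i j k : Fin n} (hij : i ≠ j) (hik : i ≠ k) (hjk : j ≠ k) :
    DCl i j * DCl i k = DCl i j * DCl j k := by
  have hmem : PD i j * PD i k - PD i j * PD j k ∈ relIdeal n :=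
    Ideal.subset_span (Or.inr ⟨i, j, k, hij, hik, hjk, Or.inl rfl⟩)
  have h0 := Ideal.Quotient.eq_zero_iff_mem.mpr hmem
  rw [map_sub, map_mul, map_mul] at h0
  exact sub_eq_zero.mp h0

lemma DCl_mul_psiCl_pow {i j : Fin n} (h : i ≠ j) (a : ℕ) :
    DCl i j * psiCl i ^ a = DCl i j * psiCl j ^ a := by
  induction a with
  | zero => simp
  | succ a ih =>
    rw [pow_succ, pow_succ, ← mul_assoc, ih, ← mul_assoc, mul_right_comm, DCl_mul_psiCl h]
    ring

lemma DCl_mul_prod_neg_DCl {i k : Fin n} (h : i ≠ k) (U : Finset (Fin n))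
    (hi : i ∉ U) (hk : k ∉ U) :
    DCl i k * ∏ j ∈ U, -DCl i j = DCl i k * ∏ j ∈ U, -DCl k j := by
  induction U using Finset.induction_on with
  | empty => simp
  | insert j U hj ih =>
    simp only [Finset.mem_insert, not_or] at hi hk
    rw [Finset.prod_insert hj, Finset.prod_insert hj]
    have h1 := ih hi.2 hk.2
    have h2 := DCl_mul_DCl h hi.1 hk.1
    linear_combination (-DCl i j) * h1 - (∏ j ∈ U, -DCl k j) * h2

/-- The class `∏_{j ∈ S, j ≠ i} (-D_{ij}) · ψ_i ^ a`. -/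
noncomputable def starCl (S : Finset (Fin n)) (a : ℕ) (i : Fin n) : Rring n :=
  (∏ j ∈ S.erase i, -DCl i j) * psiCl i ^ a

lemma starCl_eq_of_mem {S : Finset (Fin n)} {i k : Fin n} (hi : i ∈ S) (hk : k ∈ S) (a : ℕ) :
    starCl S a i = starCl S a k := by
  by_cases h : i = k
  · rw [h]
  unfold starCl
  rw [← Finset.mul_prod_erase (S.erase i) _ (Finset.mem_erase.mpr ⟨Ne.symm h, hk⟩),
    ← Finset.mul_prod_erase (S.erase k) _ (Finset.mem_erase.mpr ⟨h, hi⟩),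
    Finset.erase_right_comm, DCl_comm k i]
  have h1 := DCl_mul_prod_neg_DCl h ((S.erase k).erase i) (by simp) (by simp)
  have h2 := DCl_mul_psiCl_pow h a
  linear_combination (-psiCl i ^ a) * h1 - (∏ j ∈ (S.erase k).erase i, -DCl k j) * h2

lemma starCl_mul_psiCl (S : Finset (Fin n)) (a : ℕ) (i : Fin n) :
    starCl S a i * psiCl i = starCl S (a + 1) i := by
  unfold starCl
  ring

lemma starCl_mul_DCl {S : Finset (Fin n)} {i j : Fin n} (hj : j ∈ S) (h : i ≠ j) (a : ℕ) :
    starCl S a i * DCl i j = -starCl S (a + 1) i := by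
  unfold starCl
  rw [← Finset.mul_prod_erase (S.erase i) _ (Finset.mem_erase.mpr ⟨Ne.symm h, hj⟩)]
  linear_combination
    (-(∏ k ∈ (S.erase i).erase j, -DCl i k) * psiCl i ^ a) * DCl_mul_psiCl_left h

lemma starCl_mul_starCl_mul_DCl {S T : Finset (Fin n)} (hST : Disjoint S T) {i j : Fin n}
    (hi : i ∈ S) (hj : j ∈ T) (a b : ℕ) :
    starCl S a i * starCl T b j * DCl i j = -starCl (S ∪ T) (a + b) i := by
  have hiT : i ∉ T := Finset.disjoint_left.mp hST hi
  have h : i ≠ j := fun e => hiT (e ▸ hj)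
  unfold starCl
  have hset : (S ∪ T).erase i = S.erase i ∪ insert j (T.erase j) := by
    rw [Finset.insert_erase hj, Finset.erase_union_distrib, Finset.erase_eq_of_notMem hiT]
  have hdisj : Disjoint (S.erase i) (insert j (T.erase j)) := by
    rw [Finset.insert_erase hj]
    exact hST.mono_left (Finset.erase_subset _ _)
  rw [hset, Finset.prod_union hdisj, Finset.prod_insert (Finset.notMem_erase j T)]
  have h1 := DCl_mul_prod_neg_DCl h (T.erase j) (fun hm => hiT (Finset.mem_of_mem_erase hm))
    (Finset.notMem_erase j T)
  have h2 := DCl_mul_psiCl_pow h b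
  linear_combination
    (-(∏ k ∈ S.erase i, -DCl i k) * psiCl i ^ a * psiCl j ^ b) * h1
      - (∏ k ∈ S.erase i, -DCl i k) * psiCl i ^ a * (∏ k ∈ T.erase j, -DCl i k) * h2

lemma prod_neg_DCl (U : Finset (Fin n)) (i : Fin n) :
    ∏ j ∈ U, -DCl i j = (-1) ^ U.card * ∏ j ∈ U, DCl i j := by
  induction U using Finset.induction_on with
  | empty => simp
  | insert j U hj ih =>
    rw [Finset.prod_insert hj, Finset.prod_insert hj, Finset.card_insert_of_notMem hj, ih]
    ring

lemma DSaMin_eq_starCl {S : Finset (Fin n)} {i : Fin n} (hi : i ∈ S) (a : ℕ) :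
    DSaMin S (a + S.card - 1) = starCl S a i := by
  have hS : S.Nonempty := ⟨i, hi⟩
  have hc := hS.card_pos
  rw [starCl_eq_of_mem hi (S.min'_mem hS), DSaMin, dif_pos hS, DSa, starCl,
    show a + S.card - 1 + 1 - S.card = a by omega, ← Finset.card_erase_of_mem (S.min'_mem hS)]
  rw [prod_neg_DCl]

lemma genCl_inl (i : Fin n) : genCl (Sum.inl i) = psiCl i := rfl

lemma genCl_inr {i j : Fin n} (h : ¬ (s(i, j)).IsDiag) :
    genCl (Sum.inr ⟨s(i, j), h⟩) = DCl i j := by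
  have hij : i ≠ j := fun e => h (Sym2.mk_isDiag_iff.mpr e)
  simp [genCl, DCl, PD, hij]

end ClassRelations

section Existence

variable {n : ℕ}

/-- The product of the classes `D_{S, a(S)+|S|-1}` over the blocks of a set partition. -/
noncomputable def partitionCl (P : Finpartition (Finset.univ : Finset (Fin n)))
    (a : Finset (Fin n) → ℕ) : Rring n :=
  ∏ S ∈ P.parts, DSaMin S (a S + S.card - 1)

/-- The set partition obtained by merging two blocks. -/
def Finpartition.mergeParts (P : Finpartition (Finset.univ : Finset (Fin n)))
    {S T : Finset (Fin n)} (hS : S ∈ P.parts) (hT : T ∈ P.parts) :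
    Finpartition (Finset.univ : Finset (Fin n)) :=
  Finpartition.ofExistsUnique (insert (S ∪ T) ((P.parts.erase S).erase T))
    (fun _ _ => Finset.subset_univ _)
    (by
      intro x _
      by_cases hx : x ∈ S ∪ T
      · refine ⟨S ∪ T, ⟨Finset.mem_insert_self _ _, hx⟩, ?_⟩
        rintro U ⟨hU, hxU⟩
        simp only [Finset.mem_insert, Finset.mem_erase] at hU
        rcases hU with rfl | ⟨hUT, hUS, hU⟩
        · rfl
        · rcases Finset.mem_union.mp hx with hx | hx
          · exact absurd (P.eq_of_mem_parts hU hS hxU hx) hUS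
          · exact absurd (P.eq_of_mem_parts hU hT hxU hx) hUT
      · obtain ⟨U, hU, hxU⟩ := P.exists_mem (Finset.mem_univ x)
        rw [Finset.mem_union, not_or] at hx
        refine ⟨U, ⟨?_, hxU⟩, ?_⟩
        · simp only [Finset.mem_insert, Finset.mem_erase]
          exact Or.inr ⟨fun e => hx.2 (e ▸ hxU), fun e => hx.1 (e ▸ hxU), hU⟩
        · rintro V ⟨hV, hxV⟩
          simp only [Finset.mem_insert, Finset.mem_erase] at hV
          rcases hV with rfl | ⟨_, _, hV⟩
          · simp [hx] at hxV
          · exact P.eq_of_mem_parts hV hU hxV hxU)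
    (by
      simp only [Finset.mem_insert, Finset.mem_erase, not_or]
      exact ⟨fun h => (P.nonempty_of_mem_parts hS).ne_empty (Finset.union_eq_empty.mp h.symm).1,
        fun h => P.bot_notMem h.2.2⟩)

lemma partitionCl_bot : partitionCl (⊥ : Finpartition (Finset.univ : Finset (Fin n))) 0 = 1 := by
  unfold partitionCl
  refine Finset.prod_eq_one fun S hS => ?_
  obtain ⟨i, _, rfl⟩ := Finpartition.mem_bot_iff.mp hS
  rw [Pi.zero_apply, DSaMin_eq_starCl (Finset.mem_singleton_self i)]
  simp [starCl]

lemma partitionCl_update (P : Finpartition (Finset.univ : Finset (Fin n)))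
    (a : Finset (Fin n) → ℕ) {S : Finset (Fin n)} (hS : S ∈ P.parts) (b : ℕ) :
    partitionCl P (Function.update a S b) =
      DSaMin S (b + S.card - 1) * ∏ T ∈ P.parts.erase S, DSaMin T (a T + T.card - 1) := by
  unfold partitionCl
  rw [← Finset.mul_prod_erase _ _ hS, Function.update_self]
  congr 1
  refine Finset.prod_congr rfl fun T hT => ?_
  rw [Function.update_of_ne (Finset.ne_of_mem_erase hT)]

lemma partitionCl_eq_mul (P : Finpartition (Finset.univ : Finset (Fin n)))
    (a : Finset (Fin n) → ℕ) {S : Finset (Fin n)} (hS : S ∈ P.parts) :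
    partitionCl P a =
      DSaMin S (a S + S.card - 1) * ∏ T ∈ P.parts.erase S, DSaMin T (a T + T.card - 1) :=
  (Finset.mul_prod_erase _ _ hS).symm

lemma partitionCl_mul_psiCl (P : Finpartition (Finset.univ : Finset (Fin n)))
    (a : Finset (Fin n) → ℕ) (i : Fin n) :
    ∃ b, partitionCl P a * psiCl i = partitionCl P b := by
  obtain ⟨S, hS, hi⟩ := P.exists_mem (Finset.mem_univ i)
  refine ⟨Function.update a S (a S + 1), ?_⟩
  rw [partitionCl_update P a hS, partitionCl_eq_mul P a hS, mul_right_comm,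
    DSaMin_eq_starCl hi, starCl_mul_psiCl, DSaMin_eq_starCl hi]

lemma partitionCl_mul_DCl (P : Finpartition (Finset.univ : Finset (Fin n)))
    (a : Finset (Fin n) → ℕ) {i j : Fin n} (h : i ≠ j) :
    ∃ Q b, partitionCl P a * DCl i j = -partitionCl Q b := by
  obtain ⟨S, hS, hi⟩ := P.exists_mem (Finset.mem_univ i)
  obtain ⟨T, hT, hj⟩ := P.exists_mem (Finset.mem_univ j)
  by_cases hST : S = T
  · subst hST
    refine ⟨P, Function.update a S (a S + 1), ?_⟩
    rw [partitionCl_update P a hS, partitionCl_eq_mul P a hS, mul_right_comm,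
      DSaMin_eq_starCl hi, starCl_mul_DCl hj h, DSaMin_eq_starCl hi]
    ring
  · have hd : Disjoint S T := P.disjoint hS hT hST
    have hmem : S ∪ T ∉ (P.parts.erase S).erase T := fun hU => by
      simp only [Finset.mem_erase] at hU
      exact hU.2.1 (P.eq_of_mem_parts hU.2.2 hS (Finset.mem_union_left _ hi) hi)
    refine ⟨P.mergeParts hS hT, Function.update a (S ∪ T) (a S + a T), ?_⟩
    rw [partitionCl_update _ _ (Finset.mem_insert_self _ _), partitionCl_eq_mul P a hS,
      ← Finset.mul_prod_erase _ _ (Finset.mem_erase.mpr ⟨Ne.symm hST, hT⟩),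
      DSaMin_eq_starCl hi, DSaMin_eq_starCl hj,
      DSaMin_eq_starCl (Finset.mem_union_left T hi),
      show (P.mergeParts hS hT).parts.erase (S ∪ T) = (P.parts.erase S).erase T from
        Finset.erase_insert hmem]
    linear_combination (∏ U ∈ (P.parts.erase S).erase T, DSaMin U (a U + U.card - 1)) *
      starCl_mul_starCl_mul_DCl hd hi hj (a S) (a T)

lemma prod_genCl_eq_partitionCl (ms : Multiset (Gen n)) :
    ∃ (ε : ℚ) (P : Finpartition (Finset.univ : Finset (Fin n))) (a : Finset (Fin n) → ℕ),
      (ε = 1 ∨ ε = -1) ∧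
      (ms.map genCl).prod = algebraMap ℚ (Rring n) ε * partitionCl P a := by
  induction ms using Multiset.induction_on with
  | empty => exact ⟨1, ⊥, 0, Or.inl rfl, by simp [partitionCl_bot]⟩
  | cons g ms ih =>
    obtain ⟨ε, P, a, hε, he⟩ := ih
    rw [Multiset.map_cons, Multiset.prod_cons, he]
    rcases g with i | ⟨p, hp⟩
    · obtain ⟨b, hb⟩ := partitionCl_mul_psiCl P a i
      exact ⟨ε, P, b, hε, by rw [genCl_inl, ← hb]; ring⟩
    · induction p using Sym2.ind with
      | _ i j =>
        obtain ⟨Q, b, hb⟩ := partitionCl_mul_DCl P a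
          (fun e => hp (Sym2.mk_isDiag_iff.mpr e) : i ≠ j)
        refine ⟨-ε, Q, b, ?_, ?_⟩
        · rcases hε with rfl | rfl <;> simp
        · rw [genCl_inr, map_neg]
          linear_combination (algebraMap ℚ (Rring n) ε) * hb

end Existence

section Uniqueness

variable {n : ℕ}

/-- The image of a generator under the evaluation associated with `q : Fin n → Fin n`. -/
noncomputable def genEval (q : Fin n → Fin n) : Gen n → MvPolynomial (Fin n) ℚ :=
  Sum.elim (fun i => X (q i)) fun p =>
    Sym2.lift ⟨fun i j => if q i = q j then -X (q i) else 0, fun i j => by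
      by_cases h : q i = q j
      · simp [h]
      · simp [h, Ne.symm h]⟩ p.1

lemma aeval_genEval_Ppsi (q : Fin n → Fin n) (i : Fin n) :
    aeval (genEval q) (Ppsi i) = X (q i) := by
  simp [Ppsi, genEval]

lemma aeval_genEval_PD (q : Fin n → Fin n) {i j : Fin n} (h : i ≠ j) :
    aeval (genEval q) (PD i j) = if q i = q j then -X (q i) else 0 := by
  simp [PD, genEval, h]

/-- The homomorphism sending `ψ_i` to `x_{q(i)}`, and `D_{ij}` to `-x_{q(i)}` if `q i = q j` and
to `0` otherwise. -/
noncomputable def classEval (q : Fin n → Fin n) : Rring n →ₐ[ℚ] MvPolynomial (Fin n) ℚ :=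
  Ideal.Quotient.liftₐ (relIdeal n) (aeval (genEval q)) (by
    intro p hp
    have hle : relIdeal n ≤ RingHom.ker (aeval (genEval q) :
        MvPolynomial (Gen n) ℚ →ₐ[ℚ] MvPolynomial (Fin n) ℚ) := by
      refine Ideal.span_le.mpr ?_
      rintro p (⟨i, j, h, rfl⟩ | ⟨i, j, k, hij, hik, hjk, rfl | rfl⟩)
      · rw [SetLike.mem_coe, RingHom.mem_ker, map_add, map_mul, map_pow, aeval_genEval_PD q h,
          aeval_genEval_Ppsi]
        split_ifs <;> ring
      all_goals
        rw [SetLike.mem_coe, RingHom.mem_ker, map_sub, map_mul, map_mul, aeval_genEval_PD q hij,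
          aeval_genEval_PD q hik, aeval_genEval_PD q hjk]
        split_ifs <;> simp_all
    exact hle hp)

lemma classEval_psiCl (q : Fin n → Fin n) (i : Fin n) : classEval q (psiCl i) = X (q i) :=
  aeval_genEval_Ppsi q i

lemma classEval_DCl (q : Fin n → Fin n) {i j : Fin n} (h : i ≠ j) :
    classEval q (DCl i j) = if q i = q j then -X (q i) else 0 :=
  aeval_genEval_PD q h

lemma classEval_starCl_of_const (q : Fin n → Fin n) {S : Finset (Fin n)} {i : Fin n} (hi : i ∈ S)
    (hq : ∀ j ∈ S, q i = q j) (a : ℕ) :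
    classEval q (starCl S a i) = X (q i) ^ (a + S.card - 1) := by
  have hc : 0 < S.card := Finset.card_pos.mpr ⟨i, hi⟩
  have hprod : ∏ j ∈ S.erase i, classEval q (-DCl i j) = ∏ _j ∈ S.erase i, X (q i) :=
    Finset.prod_congr rfl fun j hj => by
      rw [map_neg, classEval_DCl q (Finset.ne_of_mem_erase hj).symm,
        if_pos (hq j (Finset.mem_of_mem_erase hj)), neg_neg]
  rw [starCl, map_mul, map_prod, map_pow, classEval_psiCl, hprod, Finset.prod_const,
    Finset.card_erase_of_mem hi, ← pow_add]
  congr 1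
  omega

lemma classEval_starCl_of_ne (q : Fin n → Fin n) {S : Finset (Fin n)} {i j : Fin n} (hj : j ∈ S)
    (hq : q i ≠ q j) (a : ℕ) : classEval q (starCl S a i) = 0 := by
  have h : i ≠ j := fun e => hq (congrArg q e)
  rw [starCl, map_mul, map_prod,
    Finset.prod_eq_zero (Finset.mem_erase.mpr ⟨h.symm, hj⟩), zero_mul]
  rw [map_neg, classEval_DCl q h, if_neg hq, neg_zero]

/-- A representative of the block containing `i`. -/
noncomputable def Finpartition.rep (P : Finpartition (Finset.univ : Finset (Fin n)))
    (i : Fin n) : Fin n :=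
  (P.part i).min' ⟨i, P.mem_part (Finset.mem_univ i)⟩

lemma Finpartition.rep_mem (P : Finpartition (Finset.univ : Finset (Fin n))) (i : Fin n) :
    P.rep i ∈ P.part i :=
  Finset.min'_mem _ _

lemma Finpartition.part_rep (P : Finpartition (Finset.univ : Finset (Fin n))) (i : Fin n) :
    P.part (P.rep i) = P.part i :=
  P.part_eq_of_mem (P.part_mem.mpr (Finset.mem_univ i)) (P.rep_mem i)

lemma Finpartition.rep_eq_rep_iff (P : Finpartition (Finset.univ : Finset (Fin n)))
    {i j : Fin n} : P.rep i = P.rep j ↔ P.part i = P.part j := by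
  refine ⟨fun h => ?_, fun h => by simp only [Finpartition.rep, h]⟩
  rw [← P.part_rep i, h, P.part_rep]

lemma Finpartition.rep_rep (P : Finpartition (Finset.univ : Finset (Fin n))) (i : Fin n) :
    P.rep (P.rep i) = P.rep i :=
  P.rep_eq_rep_iff.mpr (P.part_rep i)

/-- The exponent vector of the image of `partitionCl P a` under `classEval P.rep`. -/
noncomputable def Finpartition.exponents (P : Finpartition (Finset.univ : Finset (Fin n)))
    (a : Finset (Fin n) → ℕ) : Fin n →₀ ℕ :=
  Finsupp.equivFunOnFinite.symm fun i =>
    if P.rep i = i then a (P.part i) + (P.part i).card - 1 else 0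

lemma classEval_rep_partitionCl (P : Finpartition (Finset.univ : Finset (Fin n)))
    (a : Finset (Fin n) → ℕ) :
    classEval P.rep (partitionCl P a) = monomial (P.exponents a) 1 := by
  rw [← prod_X_pow_eq_monomial, partitionCl, map_prod]
  have hprod : ∏ i ∈ (P.exponents a).support, (X i : MvPolynomial (Fin n) ℚ) ^ P.exponents a i =
      ∏ i with P.rep i = i, X i ^ P.exponents a i := by
    refine Finset.prod_subset (fun i hi => ?_) (fun i _ hi => ?_)
    · rw [Finsupp.mem_support_iff] at hi
      rw [Finset.mem_filter]
      refine ⟨Finset.mem_univ i, by_contra fun h => hi ?_⟩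
      simp [Finpartition.exponents, h]
    · rw [Finsupp.notMem_support_iff.mp hi, pow_zero]
  rw [hprod]
  symm
  refine Finset.prod_nbij P.part (fun i _ => P.part_mem.mpr (Finset.mem_univ i)) ?_ ?_ ?_
  · intro i hi j hj hij
    simp only [Finset.coe_filter, Set.mem_ofPred_eq] at hi hj
    rw [← hi.2, ← hj.2]
    exact P.rep_eq_rep_iff.mpr hij
  · intro S hS
    obtain ⟨i, hi⟩ := P.nonempty_of_mem_parts hS
    exact ⟨P.rep i, by simp [P.rep_rep], by rw [P.part_rep, P.part_eq_of_mem hS hi]⟩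
  · intro i hi
    have hrep : P.rep i = i := (Finset.mem_filter.mp hi).2
    have hmem : i ∈ P.part i := P.mem_part (Finset.mem_univ i)
    rw [DSaMin_eq_starCl hmem, classEval_starCl_of_const P.rep hmem, hrep]
    · simp [Finpartition.exponents, hrep]
    · intro j hj
      refine P.rep_eq_rep_iff.mpr ?_
      rw [P.part_eq_of_mem (P.part_mem.mpr (Finset.mem_univ i)) hj]

lemma le_of_classEval_rep_partitionCl_ne_zero {P Q : Finpartition (Finset.univ : Finset (Fin n))}
    {a : Finset (Fin n) → ℕ} (h : classEval P.rep (partitionCl Q a) ≠ 0) : Q ≤ P := by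
  intro S hS
  obtain ⟨i, hi⟩ := Q.nonempty_of_mem_parts hS
  refine ⟨P.part i, P.part_mem.mpr (Finset.mem_univ i), fun j hj => ?_⟩
  by_contra hij
  refine h ?_
  rw [partitionCl_eq_mul Q a hS, map_mul, DSaMin_eq_starCl hi,
    classEval_starCl_of_ne P.rep hj, zero_mul]
  intro e
  exact hij (P.rep_eq_rep_iff.mp e ▸ P.mem_part (Finset.mem_univ j))

lemma partitionCl_injective {ε ε' : ℚ} {P P' : Finpartition (Finset.univ : Finset (Fin n))}
    {a a' : Finset (Fin n) → ℕ} (hε : ε ≠ 0) (hε' : ε' ≠ 0)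
    (h : algebraMap ℚ (Rring n) ε * partitionCl P a =
      algebraMap ℚ (Rring n) ε' * partitionCl P' a') :
    ε = ε' ∧ P = P' ∧ ∀ S ∈ P.parts, a S = a' S := by
  have key (q : Fin n → Fin n) :
      C ε * classEval q (partitionCl P a) = C ε' * classEval q (partitionCl P' a') := by
    have := congrArg (classEval q) h
    rwa [map_mul, map_mul, AlgHom.commutes, AlgHom.commutes] at this
  have hP : P = P' := by
    refine le_antisymm (le_of_classEval_rep_partitionCl_ne_zero (a := a) fun h0 => ?_)
      (le_of_classEval_rep_partitionCl_ne_zero (a := a') fun h0 => ?_)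
    · have := key P'.rep
      rw [h0, classEval_rep_partitionCl, C_mul_monomial, mul_one, mul_zero, eq_comm,
        monomial_eq_zero] at this
      exact hε' this
    · have := key P.rep
      rw [h0, classEval_rep_partitionCl, C_mul_monomial, mul_one, mul_zero,
        monomial_eq_zero] at this
      exact hε this
  subst hP
  have hm := key P.rep
  rw [classEval_rep_partitionCl, classEval_rep_partitionCl, C_mul_monomial, C_mul_monomial,
    mul_one, mul_one] at hm
  rcases (monomial_eq_monomial_iff _ _ _ _).mp hm with ⟨he, hc⟩ | ⟨h0, _⟩
  · refine ⟨hc, rfl, fun S hS => ?_⟩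
    obtain ⟨i, hi⟩ := P.nonempty_of_mem_parts hS
    have hSi : P.part i = S := P.part_eq_of_mem hS hi
    have hv := DFunLike.congr_fun he (P.rep i)
    simp only [Finpartition.exponents, Finsupp.equivFunOnFinite_symm_apply_apply, P.rep_rep,
      if_true, P.part_rep, hSi] at hv
    have := (P.nonempty_of_mem_parts hS).card_pos
    omega
  · exact absurd h0 hε

end Uniqueness

/-- Every monomial `M` in the generators `ψ₁, …, ψ_n`, `D_{ij}` of `R_n`
(i.e. the image in `R_n` of a product of a multiset of generators) can be written as
`M = ε · ∏_{S ∈ P} D_{S, a(S)+|S|−1}` for a sign `ε ∈ {±1}`, a set partition `P` of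
`{1,…,n}` and `a : P → ℤ_{≥0}`; moreover `ε`, `P` and `a` (on the parts of `P`) are uniquely
determined by `M`. -/
theorem monomial_unique_decomposition {n : ℕ} (hn : 1 ≤ n) (ms : Multiset (Gen n)) :
    ∃ (ε : ℚ) (P : Finpartition (Finset.univ : Finset (Fin n))) (a : Finset (Fin n) → ℕ),
      (ε = 1 ∨ ε = -1) ∧
      (ms.map genCl).prod
        = algebraMap ℚ (Rring n) ε * ∏ S ∈ P.parts, DSaMin S (a S + S.card - 1) ∧
      ∀ (ε' : ℚ) (P' : Finpartition (Finset.univ : Finset (Fin n)))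
        (a' : Finset (Fin n) → ℕ),
        (ε' = 1 ∨ ε' = -1) →
        (ms.map genCl).prod
          = algebraMap ℚ (Rring n) ε' * ∏ S ∈ P'.parts, DSaMin S (a' S + S.card - 1) →
        ε = ε' ∧ P = P' ∧ ∀ S ∈ P.parts, a S = a' S := by
  obtain ⟨ε, P, a, hε, he⟩ := prod_genCl_eq_partitionCl ms
  refine ⟨ε, P, a, hε, he, fun ε' P' a' hε' he' => ?_⟩
  refine partitionCl_injective ?_ ?_ (he.symm.trans he')
  · rcases hε with rfl | rfl <;> norm_num
  · rcases hε' with rfl | rfl <;> norm_num
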